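/- Each q_{i,n_i−j} (1 ≤ i ≤ ℓ, 1 ≤ j ≤ n_i) is a homogeneous polynomial of degree q^{m_i} − q^{m_i−j}; these n polynomials are algebraically independent over F_q and generate the invariant algebra S(V)^{P_I}, i.e. S(V)^{P_I} = F_q[q_{i,n_i−j} : 1 ≤ i ≤ ℓ, 1 ≤ j ≤ n_i] is a polynomial algebra on these generators. Consequently, the Hilbert series of S(V)^{P_I} is ∑_{d≥0} dim_{F_q}((S(V)^{P_I})_d) t^d = 1 / ∏_{i=1}^{ℓ}∏_{j=1}^{n_i}(1 − t^{q^{m_i} − q^{m_i−j}}). -/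

import Mathlib

open scoped TensorProduct
open MvPolynomial Finset

noncomputable section

/-- The symmetric algebra `S(V) = F[x_1,…,x_n]` of the natural module `V = F^n`. -/
abbrev SV (F : Type) [Field F] (n : ℕ) := MvPolynomial (Fin n) F

/-- The exterior algebra `Λ(V) = E[y_1,…,y_n]`. -/
abbrev LV (F : Type) [Field F] (n : ℕ) := ExteriorAlgebra F (Fin n → F)

/-- `S(V) ⊗ Λ(V)`. -/
abbrev SL (F : Type) [Field F] (n : ℕ) := SV F n ⊗[F] LV F n

/-- the variable `x_{a+1}` (0-indexed `a`), junk value `0` out of range. -/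
def xV (F : Type) [Field F] (n a : ℕ) : SV F n :=
  if h : a < n then X ⟨a, h⟩ else 0

/-- the exterior generator `y_{a+1}` (0-indexed `a`). -/
def yV (F : Type) [Field F] (n a : ℕ) : LV F n :=
  if h : a < n then ExteriorAlgebra.ι F (Pi.single (⟨a, h⟩ : Fin n) (1 : F)) else 0

/-- the product `y_{s_1} ⋯ y_{s_j}` over `S = {s_1 < ⋯ < s_j}` in increasing order. -/
def yProd (F : Type) [Field F] (n : ℕ) (S : Finset ℕ) : LV F n :=
  ((S.sort (· ≤ ·)).map (yV F n)).prod

/-- determinant of the matrix `(x_t^{q^c})` with rows indexed by `c ∈ R` in increasing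
order and columns by `t ∈ C` in increasing order; junk value `0` if sizes differ. -/
def subDet (F : Type) [Field F] (q n : ℕ) (R C : Finset ℕ) : SV F n :=
  if h : C.card = R.card then
    Matrix.det (Matrix.of fun i j : Fin R.card =>
      xV F n (C.orderEmbOfFin h j) ^ q ^ (R.orderEmbOfFin rfl i : ℕ))
  else 0

/-- Mui's element `M_{m;b_1,…,b_j}` where `B = {b_1 < ⋯ < b_j}` (0-indexed `b`'s);
for `B = ∅` this is the Moore determinant `det (x_t^{q^c})`. -/
def MuiM (F : Type) [Field F] (q n m : ℕ) (B : Finset ℕ) : SL F n :=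
  ∑ S ∈ (range m).powersetCard B.card,
    ((-1 : F) ^ (B.card * (B.card + 1) / 2 + (∑ s ∈ S, s) + B.card)) •
      (subDet F q n (range m \ B) (range m \ S) ⊗ₜ[F] yProd F n S)

/-- `∏_{c : F^a} (c_1 x_1 + ⋯ + c_a x_a + x_{t+1})` (0-indexed `t`). -/
def linProd (F : Type) [Field F] [Fintype F] (n a t : ℕ) : SV F n :=
  ∏ c : Fin a → F, ((∑ k : Fin a, MvPolynomial.C (c k) * xV F n k) + xV F n t)

/-- Dickson's `L_m = V_1 V_2 ⋯ V_m`. -/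
def Lm (F : Type) [Field F] [Fintype F] (n m : ℕ) : SV F n :=
  ∏ a ∈ range m, linProd F n a a

/-- The property characterizing the Dickson invariants `Q_{m,k}`:
`Q_{m,k} · L_m = L_{m,k}` in `F[x_1,…,x_m]`. -/
def DicksonProp (F : Type) [Field F] [Fintype F] (q : ℕ)
    (Q : (m : ℕ) → ℕ → SV F m) : Prop :=
  ∀ m k : ℕ, k ≤ m →
    Q m k * Lm F m m = subDet F q m (range (m + 1) \ {k}) (range m)

/-- action of a matrix on `S(V)` by linear substitution: `x_j ↦ ∑_i g_{ij} x_i`. -/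
def gAct (F : Type) [Field F] (n : ℕ) (g : Matrix (Fin n) (Fin n) F) :
    SV F n →ₐ[F] SV F n :=
  MvPolynomial.aeval fun j => ∑ i, MvPolynomial.C (g i j) * MvPolynomial.X i

/-- action of a matrix on `Λ(V)` by linear substitution: `y_j ↦ ∑_i g_{ij} y_i`. -/
def eAct (F : Type) [Field F] (n : ℕ) (g : Matrix (Fin n) (Fin n) F) :
    LV F n →ₐ[F] LV F n :=
  ExteriorAlgebra.map g.mulVecLin

/-- diagonal action of a matrix on `S(V) ⊗ Λ(V)`. -/
def tAct (F : Type) [Field F] (n : ℕ) (g : Matrix (Fin n) (Fin n) F) :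
    SL F n →ₐ[F] SL F n :=
  Algebra.TensorProduct.map (gAct F n g) (eAct F n g)

/-- the invariants of a set of matrices on `S(V) ⊗ Λ(V)`, as an `F`-subspace. -/
def invSL (F : Type) [Field F] (n : ℕ) (P : Set (Matrix (Fin n) (Fin n) F)) :
    Submodule F (SL F n) where
  carrier := {f | ∀ g ∈ P, tAct F n g f = f}
  add_mem' := fun ha hb g hg => by rw [map_add, ha g hg, hb g hg]
  zero_mem' := fun g hg => map_zero _
  smul_mem' := fun c f hf g hg => by rw [map_smul, hf g hg]

/-- the invariants of `S(V) ⊗ Λ(V) ⊗ Det^k`, i.e. elements with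
`det(g)^k (g·f) = f` for all `g ∈ P`. -/
def invSLtw (F : Type) [Field F] (n k : ℕ) (P : Set (Matrix (Fin n) (Fin n) F)) :
    Submodule F (SL F n) where
  carrier := {f | ∀ g ∈ P, g.det ^ k • tAct F n g f = f}
  add_mem' := fun ha hb g hg => by rw [map_add, smul_add, ha g hg, hb g hg]
  zero_mem' := fun g hg => by rw [map_zero, smul_zero]
  smul_mem' := fun c f hf g hg => by rw [map_smul, smul_comm, hf g hg]

/-- the invariants of a set of matrices on `S(V)`, as an `F`-subalgebra. -/
def invS (F : Type) [Field F] (n : ℕ) (P : Set (Matrix (Fin n) (Fin n) F)) :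
    Subalgebra F (SV F n) where
  carrier := {f | ∀ g ∈ P, gAct F n g f = f}
  mul_mem' := fun ha hb g hg => by rw [map_mul, ha g hg, hb g hg]
  one_mem' := fun g hg => map_one _
  add_mem' := fun ha hb g hg => by rw [map_add, ha g hg, hb g hg]
  zero_mem' := fun g hg => map_zero _
  algebraMap_mem' := fun c g hg => (gAct F n g).commutes c

/-- `v_{i,j+1}` (0-indexed `j`) for the composition `I`. -/
def vij (F : Type) [Field F] [Fintype F] (n : ℕ) (I : Composition n)
    (i : Fin I.length) (j : ℕ) : SV F n :=
  linProd F n (I.sizeUpTo i) (I.sizeUpTo i + j)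

/-- `θ_i = L_{n_i}(v_{i,1},…,v_{i,n_i})`. -/
def theta (F : Type) [Field F] [Fintype F] (n : ℕ) (I : Composition n)
    (i : Fin I.length) : SV F n :=
  MvPolynomial.aeval (fun t : Fin (I.blocksFun i) => vij F n I i t)
    (Lm F (I.blocksFun i) (I.blocksFun i))

/-- `q_{i,k} = Q_{n_i,k}(v_{i,1},…,v_{i,n_i})`, given the Dickson polynomials `Q`. -/
def qInv (F : Type) [Field F] [Fintype F] (n : ℕ) (Q : (m : ℕ) → ℕ → SV F m)
    (I : Composition n) (i : Fin I.length) (k : ℕ) : SV F n :=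
  MvPolynomial.aeval (fun t : Fin (I.blocksFun i) => vij F n I i t)
    (Q (I.blocksFun i) k)

/-- the index of the block (0-indexed) of the composition `I` containing `a`. -/
def blkIdx (n : ℕ) (I : Composition n) (a : ℕ) : ℕ :=
  ((range I.length).filter fun i => I.sizeUpTo (i + 1) ≤ a).card

/-- the parabolic subgroup `P_I`: invertible block upper-triangular matrices. -/
def PIset (F : Type) [Field F] (n : ℕ) (I : Composition n) :
    Set (Matrix (Fin n) (Fin n) F) :=
  {g | IsUnit g.det ∧ ∀ a b : Fin n, blkIdx n I b < blkIdx n I a → g a b = 0}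

/-- the subgroup `K_I ≤ P_I`: block upper-triangular with all diagonal blocks
of determinant `1`. -/
def KIset (F : Type) [Field F] (n : ℕ) (I : Composition n) :
    Set (Matrix (Fin n) (Fin n) F) :=
  {g | IsUnit g.det ∧ (∀ a b : Fin n, blkIdx n I b < blkIdx n I a → g a b = 0) ∧
    ∀ i : Fin I.length,
      Matrix.det (Matrix.of fun a b : Fin (I.blocksFun i) =>
        g (I.embedding i a) (I.embedding i b)) = 1}

/-- the unipotent subgroup `U_n` of uni-uppertriangular matrices. -/
def Uset (F : Type) [Field F] (n : ℕ) : Set (Matrix (Fin n) (Fin n) F) :=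
  {g | (∀ a b : Fin n, b < a → g a b = 0) ∧ ∀ a : Fin n, g a a = 1}

/-- `SL_n(q)`. -/
def SLset (F : Type) [Field F] (n : ℕ) : Set (Matrix (Fin n) (Fin n) F) :=
  {g | g.det = 1}

/-- `GL_n(q)`. -/
def GLset (F : Type) [Field F] (n : ℕ) : Set (Matrix (Fin n) (Fin n) F) :=
  {g | IsUnit g.det}

/-- the bigraded piece `S^i(V) ⊗ Λ^j(V)` of `S(V) ⊗ Λ(V)`. -/
def piece (F : Type) [Field F] (n i j : ℕ) : Submodule F (SL F n) :=
  LinearMap.range (TensorProduct.map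
    (MvPolynomial.homogeneousSubmodule (Fin n) F i).subtype
    (LinearMap.range (ExteriorAlgebra.ι F (M := Fin n → F)) ^ j).subtype)

/-- the Hilbert series in `ℤ[s][[t]]` of a bigraded subspace `W` of `S(V) ⊗ Λ(V)`:
the coefficient of `t^i` is `∑_{j=0}^n dim (W ∩ (S^i ⊗ Λ^j)) s^j`. -/
def Hser (F : Type) [Field F] (n : ℕ) (W : Submodule F (SL F n)) :
    PowerSeries (Polynomial ℤ) :=
  PowerSeries.mk fun i => ∑ j ∈ range (n + 1),
    Polynomial.C (Module.finrank F ↥(W ⊓ piece F n i j) : ℤ) * Polynomial.X ^ j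

/-- the Hilbert series in `ℤ[[t]]` of a graded subalgebra of `S(V)`. -/
def HserS (F : Type) [Field F] (n : ℕ) (W : Subalgebra F (SV F n)) :
    PowerSeries ℤ :=
  PowerSeries.mk fun d =>
    (Module.finrank F ↥(Subalgebra.toSubmodule W ⊓ MvPolynomial.homogeneousSubmodule (Fin n) F d) : ℤ)

/-- the index set for Mui-type basis elements attached to the composition `I`:
pairs `(i, B)` with `B = {b_1 < ⋯ < b_j} ⊆ {0,…,m_{i+1}−1}` nonempty and
`max B ≥ m_i` (0-indexed `i`). -/
def Adm (n : ℕ) (I : Composition n) : Finset (Fin I.length × Finset ℕ) :=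
  (Finset.univ ×ˢ (range n).powerset).filter fun x =>
    x.2 ⊆ range (I.sizeUpTo ((x.1 : ℕ) + 1)) ∧ x.2.Nonempty ∧ ∃ b ∈ x.2, I.sizeUpTo (x.1 : ℕ) ≤ b

section Moore

variable {F : Type} [Field F]

/-- The minor of the Moore matrix of `w` which omits the power `q ^ k`. -/
def mooreMinor (q : ℕ) {R : Type*} [CommRing R] {m : ℕ} (w : Fin m → R) (k : Fin (m + 1)) : R :=
  Matrix.det (Matrix.of fun i j : Fin m => w j ^ q ^ (k.succAbove i : ℕ))

/-- The Laplace expansion of the Moore determinant of `w` and an indeterminate. -/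
def moorePoly (q : ℕ) {R : Type*} [CommRing R] {m : ℕ} (w : Fin m → R) : Polynomial R :=
  ∑ k : Fin (m + 1), Polynomial.C ((-1) ^ ((k : ℕ) + m) * mooreMinor q w k) *
    Polynomial.X ^ q ^ (k : ℕ)

lemma eval_moorePoly (q : ℕ) {R : Type*} [CommRing R] {m : ℕ} (w : Fin m → R) (y : R) :
    (moorePoly q w).eval y = Matrix.det (Matrix.of fun i j : Fin (m + 1) =>
      (Fin.snoc w y : Fin (m + 1) → R) j ^ q ^ (i : ℕ)) := by
  rw [Matrix.det_succ_column _ (Fin.last m), moorePoly, Polynomial.eval_finsetSum]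
  refine Finset.sum_congr rfl fun k _ => ?_
  simp only [Polynomial.eval_mul, Polynomial.eval_C, Polynomial.eval_pow, Polynomial.eval_X,
    Matrix.of_apply, Fin.snoc_last, Fin.val_last, mooreMinor]
  have : (Matrix.of fun i j : Fin (m + 1) =>
      (Fin.snoc w y : Fin (m + 1) → R) j ^ q ^ (i : ℕ)).submatrix k.succAbove
        (Fin.last m).succAbove = Matrix.of fun i j : Fin m => w j ^ q ^ (k.succAbove i : ℕ) := by
    ext i j
    simp
  rw [this]
  ring

lemma coeff_moorePoly {q : ℕ} (hq : 1 < q) {R : Type*} [CommRing R] {m : ℕ} (w : Fin m → R)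
    (k : Fin (m + 1)) :
    (moorePoly q w).coeff (q ^ (k : ℕ)) = (-1) ^ ((k : ℕ) + m) * mooreMinor q w k := by
  simp only [moorePoly, Polynomial.finsetSum_coeff, Polynomial.coeff_C_mul, Polynomial.coeff_X_pow]
  rw [Finset.sum_eq_single k]
  · simp
  · intro b _ hb
    rw [if_neg, mul_zero]
    intro h
    exact hb (Fin.ext (Nat.pow_right_injective hq h).symm)
  · simp

lemma natDegree_moorePoly_le {q : ℕ} (hq : 1 < q) {R : Type*} [CommRing R] {m : ℕ}
    (w : Fin m → R) :
    (moorePoly q w).natDegree ≤ q ^ m := by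
  refine Polynomial.natDegree_sum_le_of_forall_le _ _ fun k _ => ?_
  refine (Polynomial.natDegree_C_mul_X_pow_le _ _).trans ?_
  exact Nat.pow_le_pow_right (by omega) (by omega)

/-- The first `a` variables of `S(V)`. -/
def firstVars (F : Type) [Field F] (n a : ℕ) : Fin a → SV F n := fun k => xV F n k

lemma linearIndependent_firstVars {n a : ℕ} (ha : a ≤ n) :
    LinearIndependent F (firstVars F n a) := by
  have h : firstVars F n a = (X : Fin n → SV F n) ∘ Fin.castLE ha := by
    ext1 k
    simp [firstVars, xV, show (k : ℕ) < n by omega, Fin.castLE]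
  rw [h]
  exact (MvPolynomial.linearIndependent_X (Fin n) F).comp _ (Fin.castLE_injective ha)

lemma firstVars_succ (n a : ℕ) :
    firstVars F n (a + 1) = (Fin.snoc (firstVars F n a) (xV F n a) : Fin (a + 1) → SV F n) := by
  ext1 k
  refine Fin.lastCases ?_ (fun k => ?_) k <;> simp [firstVars]

lemma subDet_eq (q n : ℕ) {m : ℕ} {R C : Finset ℕ} (hR : R.card = m) (hC : C.card = m)
    {f g : Fin m → ℕ} (hf : StrictMono f) (hg : StrictMono g) (hfR : ∀ i, f i ∈ R)
    (hgC : ∀ i, g i ∈ C) :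
    subDet F q n R C = Matrix.det (Matrix.of fun i j => xV F n (g j) ^ q ^ f i) := by
  subst hR
  rw [subDet, dif_pos hC, Finset.orderEmbOfFin_unique rfl hfR hf,
    Finset.orderEmbOfFin_unique hC hgC hg]

lemma subDet_eq_mooreMinor (q n m : ℕ) (k : Fin (m + 1)) :
    subDet F q n (range (m + 1) \ {(k : ℕ)}) (range m) = mooreMinor q (firstVars F n m) k := by
  rw [subDet_eq q n (m := m) (f := fun i => (k.succAbove i : ℕ)) (g := fun i => (i : ℕ))]
  · rfl
  · rw [Finset.card_sdiff_of_subset (by simpa using k.is_le)]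
    simp
  · simp
  · exact fun i j h => Fin.strictMono_succAbove k h
  · exact fun i j h => h
  · intro i
    simp only [mem_sdiff, mem_range, Finset.mem_singleton]
    exact ⟨(k.succAbove i).2, fun h => Fin.succAbove_ne k i (Fin.ext h)⟩
  · simp

variable [Fintype F]

lemma smul_sum_pow_card_pow {R : Type*} [CommRing R] [Algebra F R] {ι : Type*} (s : Finset ι)
    (c : ι → F) (w : ι → R) (i : ℕ) :
    (∑ k ∈ s, c k • w k) ^ Fintype.card F ^ i =
      ∑ k ∈ s, c k • w k ^ Fintype.card F ^ i := by
  have key : ∀ x : R, (FiniteField.frobeniusAlgHom F R ^ i) x = x ^ Fintype.card F ^ i := by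
    intro x
    rw [AlgHom.coe_pow, FiniteField.coe_frobeniusAlgHom, pow_iterate]
  simp only [← key, map_sum, map_smul]

/-- The monic polynomial whose roots are the negatives of the `F`-linear combinations of `w`. -/
def spanPoly (F : Type) [Field F] [Fintype F] {R : Type*} [CommRing R] [Algebra F R] {m : ℕ}
    (w : Fin m → R) : Polynomial R :=
  ∏ c : Fin m → F, (Polynomial.X + Polynomial.C (∑ k, c k • w k))

lemma eval_moorePoly_eq_zero {R : Type*} [CommRing R] [IsDomain R] [Algebra F R] {m : ℕ}
    (w : Fin m → R) (c : Fin m → F) :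
    (moorePoly (Fintype.card F) w).eval (∑ k, c k • w k) = 0 := by
  rw [eval_moorePoly, ← Matrix.exists_mulVec_eq_zero_iff]
  refine ⟨Fin.snoc (fun k => algebraMap F R (c k)) (-1), fun h => ?_, ?_⟩
  · simpa using congrFun h (Fin.last m)
  · ext i
    simp only [Matrix.mulVec, dotProduct, Fin.sum_univ_castSucc, Matrix.of_apply,
      Fin.snoc_castSucc, Fin.snoc_last, smul_sum_pow_card_pow, Pi.zero_apply]
    simp [Algebra.smul_def, mul_comm]

lemma monic_spanPoly {R : Type*} [CommRing R] [Algebra F R] {m : ℕ} (w : Fin m → R) :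
    (spanPoly F w).Monic :=
  Polynomial.monic_prod_of_monic _ _ fun _ _ => Polynomial.monic_X_add_C _

lemma natDegree_spanPoly {R : Type*} [CommRing R] [Nontrivial R] [Algebra F R] {m : ℕ}
    (w : Fin m → R) : (spanPoly F w).natDegree = Fintype.card F ^ m := by
  rw [spanPoly, Polynomial.natDegree_prod_of_monic _ _ fun _ _ => Polynomial.monic_X_add_C _]
  simp [-map_sum]

lemma eval_spanPoly {R : Type*} [CommRing R] [Algebra F R] {m : ℕ} (w : Fin m → R) (y : R) :
    (spanPoly F w).eval y = ∏ c : Fin m → F, (y + ∑ k, c k • w k) := by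
  simp [spanPoly, Polynomial.eval_prod, -map_sum]

lemma moorePoly_eq {R : Type*} [CommRing R] [IsDomain R] [Algebra F R] {m : ℕ}
    {w : Fin m → R} (hw : LinearIndependent F w) :
    moorePoly (Fintype.card F) w =
      Polynomial.C (mooreMinor (Fintype.card F) w (Fin.last m)) * spanPoly F w := by
  classical
  have hq : 1 < Fintype.card F := Fintype.one_lt_card
  have hinj : Function.Injective fun c : Fin m → F => ∑ k, c k • w k := by
    have := linearIndependent_iff_injective_fintypeLinearCombination.mp hw
    intro a b hab
    exact this (by simpa [Fintype.linearCombination_apply] using hab)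
  set s : Finset R := Finset.univ.image fun c : Fin m → F => ∑ k, c k • w k with hs
  have hcard : s.card = Fintype.card F ^ m := by
    rw [hs, Finset.card_image_of_injective _ hinj]
    simp
  refine Polynomial.eq_of_degree_sub_lt_of_eval_finset_eq s ?_ ?_
  · rw [hcard, Polynomial.degree_lt_iff_coeff_zero]
    intro d hd
    rw [Polynomial.coeff_sub, Polynomial.coeff_C_mul]
    rcases hd.eq_or_lt with rfl | hd
    · have h1 := coeff_moorePoly hq w (Fin.last m)
      have h2 := (monic_spanPoly (F := F) w).coeff_natDegree
      rw [natDegree_spanPoly] at h2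
      rw [Fin.val_last] at h1
      rw [h1, h2, ← two_mul, pow_mul]
      simp
    · rw [Polynomial.coeff_eq_zero_of_natDegree_lt ((natDegree_moorePoly_le hq w).trans_lt hd),
        Polynomial.coeff_eq_zero_of_natDegree_lt (by rwa [natDegree_spanPoly])]
      simp
  · intro x hx
    obtain ⟨c, -, rfl⟩ := Finset.mem_image.mp hx
    rw [eval_moorePoly_eq_zero, Polynomial.eval_mul, eval_spanPoly,
      Finset.prod_eq_zero (Finset.mem_univ (-c)), mul_zero]
    simp

lemma mooreMinor_last_snoc {R : Type*} [CommRing R] [IsDomain R] [Algebra F R] {m : ℕ}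
    {w : Fin m → R} (hw : LinearIndependent F w) (y : R) :
    mooreMinor (Fintype.card F) (Fin.snoc w y : Fin (m + 1) → R) (Fin.last (m + 1)) =
      mooreMinor (Fintype.card F) w (Fin.last m) * (spanPoly F w).eval y := by
  have h := eval_moorePoly (Fintype.card F) w y
  rw [moorePoly_eq hw, Polynomial.eval_mul, Polynomial.eval_C] at h
  rw [h]
  simp [mooreMinor]

lemma linProd_eq (n a t : ℕ) :
    linProd F n a t = (spanPoly F (firstVars F n a)).eval (xV F n t) := by
  simp [linProd, eval_spanPoly, firstVars, smul_eq_C_mul, add_comm]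

lemma Lm_succ (n a : ℕ) : Lm F n (a + 1) = Lm F n a * linProd F n a a :=
  Finset.prod_range_succ _ _

lemma Lm_eq_mooreMinor {n a : ℕ} (ha : a ≤ n) :
    Lm F n a = mooreMinor (Fintype.card F) (firstVars F n a) (Fin.last a) := by
  induction a with
  | zero => simp [Lm, mooreMinor]
  | succ a ih =>
    have ha' : a ≤ n := Nat.le_of_succ_le ha
    have h := mooreMinor_last_snoc (linearIndependent_firstVars (F := F) ha') (xV F n a)
    rw [← firstVars_succ, ← ih ha', ← linProd_eq] at h
    exact (Lm_succ n a).trans h.symm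

lemma Lm_ne_zero {n a : ℕ} (ha : a ≤ n) : Lm F n a ≠ 0 := by
  refine Finset.prod_ne_zero_iff.mpr fun b hb => ?_
  have hb := Finset.mem_range.mp hb
  have hli := linearIndependent_firstVars (F := F) (n := n) (a := b + 1) (by omega)
  rw [linProd_eq, eval_spanPoly]
  refine Finset.prod_ne_zero_iff.mpr fun c _ h => ?_
  have := Fintype.linearIndependent_iff.mp hli (Fin.snoc c 1) (by
    rw [Fin.sum_univ_castSucc, ← h, firstVars_succ]
    simp [add_comm]) (Fin.last b)
  simp at this

lemma spanPoly_firstVars {Q : (m : ℕ) → ℕ → SV F m} (hQ : DicksonProp F (Fintype.card F) Q)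
    (m : ℕ) :
    spanPoly F (firstVars F m m) = ∑ k : Fin (m + 1),
      Polynomial.C ((-1) ^ ((k : ℕ) + m) * Q m k) * Polynomial.X ^ Fintype.card F ^ (k : ℕ) := by
  have hL := Lm_ne_zero (F := F) (le_refl m)
  have h := moorePoly_eq (linearIndependent_firstVars (F := F) (le_refl m))
  rw [← Lm_eq_mooreMinor le_rfl] at h
  refine mul_left_cancel₀ (Polynomial.C_ne_zero.mpr hL) (h.symm.trans ?_)
  rw [moorePoly, Finset.mul_sum]
  refine Finset.sum_congr rfl fun k _ => ?_
  rw [← subDet_eq_mooreMinor, ← hQ m k (by omega), ← mul_assoc (Polynomial.C _),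
    ← Polynomial.C_mul]
  congr 2
  ring

lemma map_spanPoly {R R' : Type*} [CommRing R] [Algebra F R] [CommRing R'] [Algebra F R']
    (φ : R →ₐ[F] R') {m : ℕ} (w : Fin m → R) :
    (spanPoly F w).map (φ : R →+* R') = spanPoly F (fun k => φ (w k)) := by
  simp [spanPoly, Polynomial.map_prod, Polynomial.map_sum]

/-- Dickson's expansion of the product of all translates of `X` by the span of `w`. -/
lemma spanPoly_eq {Q : (m : ℕ) → ℕ → SV F m} (hQ : DicksonProp F (Fintype.card F) Q)
    {R : Type*} [CommRing R] [Algebra F R] {m : ℕ} (w : Fin m → R) :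
    spanPoly F w = ∑ k : Fin (m + 1),
      Polynomial.C ((-1) ^ ((k : ℕ) + m) * MvPolynomial.aeval w (Q m k)) *
        Polynomial.X ^ Fintype.card F ^ (k : ℕ) := by
  have h := congrArg (Polynomial.map (MvPolynomial.aeval w : SV F m →ₐ[F] R).toRingHom)
    (spanPoly_firstVars hQ m)
  have hw : (fun k => (MvPolynomial.aeval w : SV F m →ₐ[F] R) (firstVars F m m k)) = w := by
    ext1 k
    simp [firstVars, xV]
  rw [AlgHom.toRingHom_eq_coe, map_spanPoly, hw] at h
  rw [h, Polynomial.map_sum]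
  simp

lemma coeff_spanPoly {Q : (m : ℕ) → ℕ → SV F m} (hQ : DicksonProp F (Fintype.card F) Q)
    {R : Type*} [CommRing R] [Algebra F R] {m : ℕ} (w : Fin m → R) {k : ℕ} (hk : k ≤ m) :
    (spanPoly F w).coeff (Fintype.card F ^ k) =
      (-1) ^ (k + m) * MvPolynomial.aeval w (Q m k) := by
  rw [spanPoly_eq hQ, Polynomial.finsetSum_coeff, Finset.sum_eq_single ⟨k, by omega⟩]
  · simp only [Polynomial.coeff_C_mul, Polynomial.coeff_X_pow, if_true, mul_one]
  · intro b _ hb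
    rw [Polynomial.coeff_C_mul, Polynomial.coeff_X_pow, if_neg, mul_zero]
    intro h
    exact hb (Fin.ext (Nat.pow_right_injective Fintype.one_lt_card h).symm)
  · simp

lemma Q_self {Q : (m : ℕ) → ℕ → SV F m} (hQ : DicksonProp F (Fintype.card F) Q) (m : ℕ) :
    Q m m = 1 := by
  have h := coeff_spanPoly hQ (X : Fin m → SV F m) le_rfl
  have h2 := (monic_spanPoly (F := F) (X : Fin m → SV F m)).coeff_natDegree
  rw [natDegree_spanPoly, h, ← two_mul, pow_mul] at h2
  simpa using h2

lemma isHomogeneous_Q {Q : (m : ℕ) → ℕ → SV F m} (hQ : DicksonProp F (Fintype.card F) Q)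
    {m k : ℕ} (hk : k ≤ m) :
    (Q m k).IsHomogeneous (Fintype.card F ^ m - Fintype.card F ^ k) := by
  have h := coeff_spanPoly hQ (X : Fin m → SV F m) hk
  have hQe : Q m k = C ((-1) ^ (k + m)) *
      (spanPoly F (X : Fin m → SV F m)).coeff (Fintype.card F ^ k) := by
    rw [h, map_pow, map_neg, map_one, ← mul_assoc, ← pow_add, ← two_mul, pow_mul]
    simp
  have hcard : (Finset.univ : Finset (Fin m → F)).card = Fintype.card F ^ m := by simp
  rw [hQe]
  refine MvPolynomial.IsHomogeneous.C_mul ?_ _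
  rw [spanPoly, Finset.prod_X_add_C_coeff _ _ (by
    rw [hcard]
    exact Nat.pow_le_pow_right Fintype.card_pos hk)]
  refine MvPolynomial.IsHomogeneous.sum _ _ _ fun t ht => ?_
  have ht := (Finset.mem_powersetCard.mp ht).2
  rw [← hcard, ← ht, ← mul_one t.card, Finset.card_eq_sum_ones, Finset.sum_mul]
  refine MvPolynomial.IsHomogeneous.prod _ _ _ fun c _ => ?_
  refine MvPolynomial.IsHomogeneous.sum _ _ _ fun j _ => ?_
  rw [smul_eq_C_mul]
  exact (isHomogeneous_X _ j).C_mul _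

end Moore

section Flag

variable {F : Type} [Field F]

/-- The linear form with coefficient vector `u`. -/
def linForm (n : ℕ) (u : Fin n → F) : SV F n := ∑ k, u k • X k

lemma linForm_injective (n : ℕ) : Function.Injective (linForm (F := F) n) := by
  have := linearIndependent_iff_injective_fintypeLinearCombination.mp
    (MvPolynomial.linearIndependent_X (Fin n) F)
  intro a b hab
  exact this (by simpa [Fintype.linearCombination_apply, linForm] using hab)

lemma algHom_linForm {R : Type*} [CommRing R] [Algebra F R] {n : ℕ} (φ : SV F n →ₐ[F] R)
    (g : Matrix (Fin n) (Fin n) F) {ψ : SV F n →ₐ[F] R}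
    (h : ∀ j, φ (X j) = ψ (linForm n fun i => g i j)) (u : Fin n → F) :
    φ (linForm n u) = ψ (linForm n (g.mulVec u)) := by
  have h' : φ (linForm n u) = ψ (∑ j, u j • linForm n fun i => g i j) := by
    simp [linForm, h]
  rw [h']
  congr 1
  simp only [linForm, Finset.smul_sum, Matrix.mulVec, dotProduct, Finset.sum_smul, smul_smul]
  rw [Finset.sum_comm]
  simp only [mul_comm]

lemma gAct_X {n : ℕ} (g : Matrix (Fin n) (Fin n) F) (j : Fin n) :
    gAct F n g (X j) = linForm n fun i => g i j := by
  simp [gAct, linForm, smul_eq_C_mul]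

lemma lt_blkIdx_iff {n : ℕ} (I : Composition n) {i a : ℕ} (hi : i < I.length) :
    i < blkIdx n I a ↔ I.sizeUpTo (i + 1) ≤ a := by
  have hmono := I.monotone_sizeUpTo
  constructor
  · intro h
    by_contra! hlt
    refine h.not_ge ?_
    refine (Finset.card_le_card (t := range i) fun j hj => ?_).trans_eq (Finset.card_range i)
    rw [Finset.mem_filter] at hj
    rw [Finset.mem_range]
    by_contra! hij
    have := hmono (show i + 1 ≤ j + 1 by omega)
    omega
  · intro h
    rw [Nat.lt_iff_add_one_le, ← Finset.card_range (i + 1)]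
    refine Finset.card_le_card fun j hj => ?_
    rw [Finset.mem_range] at hj
    rw [Finset.mem_filter, Finset.mem_range]
    exact ⟨by omega, (hmono (show j + 1 ≤ i + 1 by omega)).trans h⟩

lemma blkIdx_lt_length {n : ℕ} (I : Composition n) (a : Fin n) : blkIdx n I a < I.length := by
  have h0 : 0 < I.length := I.length_pos_of_pos (by have := a.2; omega)
  by_contra! h
  have := (lt_blkIdx_iff I (i := I.length - 1) (a := a) (by omega)).mp (by omega)
  rw [Nat.sub_add_cancel h0, I.sizeUpTo_length] at this
  omega

/-- The coefficient vectors supported on the first `a` coordinates. -/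
def flagSet (F : Type) [Field F] (n a : ℕ) : Set (Fin n → F) :=
  {u | ∀ k : Fin n, a ≤ k → u k = 0}

lemma mulVec_mem_flagSet {n : ℕ} (I : Composition n) {g : Matrix (Fin n) (Fin n) F}
    (hg : g ∈ PIset F n I) {i : ℕ} (hi : i ≤ I.length) {u : Fin n → F}
    (hu : u ∈ flagSet F n (I.sizeUpTo i)) : g.mulVec u ∈ flagSet F n (I.sizeUpTo i) := by
  intro k hk
  change ∑ b, g k b * u b = 0
  refine Finset.sum_eq_zero fun b _ => ?_
  by_cases hb : I.sizeUpTo i ≤ b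
  · rw [hu b hb, mul_zero]
  · rw [hg.2 k b, zero_mul]
    obtain _ | i := i
    · simp at hb
    · have h1 := (lt_blkIdx_iff I (a := k) (by omega : i < I.length)).mpr hk
      have h2 := (lt_blkIdx_iff I (a := b) (by omega : i < I.length)).not.mpr hb
      omega

variable [Fintype F]

lemma add_pow_card_pow {R : Type*} [CommRing R] [Algebra F R] (x y : R) (i : ℕ) :
    (x + y) ^ Fintype.card F ^ i = x ^ Fintype.card F ^ i + y ^ Fintype.card F ^ i := by
  simpa using smul_sum_pow_card_pow (F := F) Finset.univ (fun _ : Fin 2 => (1 : F)) ![x, y] i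

lemma spanPoly_comp_X_add_C {Q : (m : ℕ) → ℕ → SV F m}
    (hQ : DicksonProp F (Fintype.card F) Q) {R : Type*} [CommRing R] [Algebra F R] {m b : ℕ}
    (w : Fin m → R) (c : Fin b → F) (z : Fin b → R) :
    (spanPoly F w).comp (Polynomial.X + Polynomial.C (∑ j, c j • z j)) =
      spanPoly F w + Polynomial.C (∑ j, c j • (spanPoly F w).eval (z j)) := by
  rw [spanPoly_eq hQ]
  simp only [Polynomial.sum_comp, Polynomial.mul_comp, Polynomial.C_comp,
    Polynomial.X_pow_comp, add_pow_card_pow, mul_add, Finset.sum_add_distrib,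
    ← Polynomial.C_pow, smul_sum_pow_card_pow, Polynomial.eval_finsetSum, Polynomial.eval_mul,
    Polynomial.eval_C, Polynomial.eval_pow, Polynomial.eval_X, ← Polynomial.C_mul]
  congr 1
  rw [← map_sum]
  congr 1
  simp only [Finset.mul_sum, Finset.smul_sum, mul_smul_comm]
  exact Finset.sum_comm

lemma spanPoly_firstVars_add {Q : (m : ℕ) → ℕ → SV F m}
    (hQ : DicksonProp F (Fintype.card F) Q) (n a b : ℕ) :
    spanPoly F (firstVars F n (a + b)) =
      (spanPoly F fun j : Fin b => linProd F n a (a + j)).comp (spanPoly F (firstVars F n a)) := by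
  have h1 : spanPoly F (firstVars F n (a + b)) = ∏ c : (Fin a → F) × (Fin b → F),
      (Polynomial.X + Polynomial.C (∑ j, c.2 j • xV F n (a + j)) +
        Polynomial.C (∑ k, c.1 k • firstVars F n a k)) := by
    rw [spanPoly, ← (Fin.appendEquiv a b).prod_comp]
    refine Finset.prod_congr rfl fun c _ => ?_
    rw [add_assoc, ← Polynomial.C_add, Fin.sum_univ_add, add_comm (∑ j, c.2 j • _)]
    simp [Fin.appendEquiv, firstVars]
  rw [h1, Fintype.prod_prod_type_right, spanPoly.eq_def (F := F) fun j : Fin b => _,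
    Polynomial.prod_comp]
  refine Finset.prod_congr rfl fun c _ => ?_
  have h2 := spanPoly_comp_X_add_C hQ (firstVars F n a) c fun j => xV F n (a + j)
  simp only [Polynomial.add_comp, Polynomial.X_comp, Polynomial.C_comp, linProd_eq]
  rw [← h2, spanPoly, Polynomial.prod_comp]
  simp only [Polynomial.add_comp, Polynomial.X_comp, Polynomial.C_comp]

open Classical in
lemma spanPoly_firstVars_eq_prod {n a : ℕ} (ha : a ≤ n) :
    spanPoly F (firstVars F n a) =
      ∏ u : flagSet F n a, (Polynomial.X + Polynomial.C (linForm n (u : Fin n → F))) := by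
  rw [spanPoly]
  refine Fintype.prod_bijective
    (fun c => ⟨fun k => if h : (k : ℕ) < a then c ⟨k, h⟩ else 0, fun k hk => by
      simp [hk]⟩) ⟨fun c d hcd => ?_, fun u => ⟨fun k => u.1 (k.castLE ha), ?_⟩⟩ _ _ fun c => ?_
  · ext1 k
    simpa using congrFun (Subtype.ext_iff.mp hcd) (k.castLE ha)
  · ext k
    by_cases h : (k : ℕ) < a
    · simp [h, Fin.castLE]
    · simp [h, u.2 k (by omega)]
  · congr 2
    rw [linForm]
    refine Finset.sum_of_injOn (Fin.castLE ha) (Fin.castLE_injective ha).injOn (by simp) ?_ ?_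
    · intro k _ hk
      have : ¬ (k : ℕ) < a := fun h => hk ⟨⟨k, h⟩, by simp, rfl⟩
      simp [this]
    · intro k _
      simp [firstVars, xV, show (k : ℕ) < n by omega, Fin.castLE]

lemma map_gAct_spanPoly_firstVars {n : ℕ} (I : Composition n) {g : Matrix (Fin n) (Fin n) F}
    (hg : g ∈ PIset F n I) {i : ℕ} (hi : i ≤ I.length) :
    (spanPoly F (firstVars F n (I.sizeUpTo i))).map (gAct F n g : SV F n →+* SV F n) =
      spanPoly F (firstVars F n (I.sizeUpTo i)) := by
  classical
  rw [spanPoly_firstVars_eq_prod (I.sizeUpTo_le i), Polynomial.map_prod]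
  have hinj : Function.Injective fun u : flagSet F n (I.sizeUpTo i) =>
      (⟨g.mulVec u.1, mulVec_mem_flagSet I hg hi u.2⟩ : flagSet F n (I.sizeUpTo i)) :=
    fun u v huv => Subtype.ext (Matrix.mulVec_injective_iff_isUnit.mpr
      ((Matrix.isUnit_iff_isUnit_det g).mpr hg.1) (Subtype.ext_iff.mp huv))
  refine Fintype.prod_bijective _ (Finite.injective_iff_bijective.mp hinj) _ _ fun u => ?_
  have := algHom_linForm (gAct F n g) g (ψ := AlgHom.id F _) (by simp [gAct_X]) u.1
  simp [this]

/-- The polynomial of the span of `v_{i,1}, …, v_{i,n_i}`. -/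
def blockPoly (F : Type) [Field F] [Fintype F] {n : ℕ} (I : Composition n) (i : Fin I.length) :
    Polynomial (SV F n) :=
  spanPoly F fun j : Fin (I.blocksFun i) => vij F n I i j

lemma spanPoly_firstVars_sizeUpTo_succ {Q : (m : ℕ) → ℕ → SV F m}
    (hQ : DicksonProp F (Fintype.card F) Q) {n : ℕ} (I : Composition n) (i : Fin I.length) :
    spanPoly F (firstVars F n (I.sizeUpTo ((i : ℕ) + 1))) =
      (blockPoly F I i).comp (spanPoly F (firstVars F n (I.sizeUpTo i))) := by
  rw [I.sizeUpTo_succ', spanPoly_firstVars_add hQ]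
  rfl

lemma comp_spanPoly_injective {R : Type*} [CommRing R] [IsDomain R] [Algebra F R] {m : ℕ}
    (w : Fin m → R) : Function.Injective fun p : Polynomial R => p.comp (spanPoly F w) := by
  intro p p' h
  have h0 : (p - p').comp (spanPoly F w) = 0 := by
    rw [Polynomial.sub_comp, sub_eq_zero]
    exact h
  rcases Polynomial.comp_eq_zero_iff.mp h0 with h1 | ⟨-, h1⟩
  · exact sub_eq_zero.mp h1
  · have h2 := natDegree_spanPoly (F := F) w
    rw [h1, Polynomial.natDegree_C] at h2
    have : 0 < Fintype.card F ^ m := pow_pos Fintype.card_pos m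
    omega

lemma map_gAct_blockPoly {Q : (m : ℕ) → ℕ → SV F m}
    (hQ : DicksonProp F (Fintype.card F) Q) {n : ℕ} (I : Composition n)
    {g : Matrix (Fin n) (Fin n) F} (hg : g ∈ PIset F n I) (i : Fin I.length) :
    (blockPoly F I i).map (gAct F n g : SV F n →+* SV F n) = blockPoly F I i := by
  apply comp_spanPoly_injective (F := F) (firstVars F n (I.sizeUpTo i))
  have h := map_gAct_spanPoly_firstVars I hg (i := (i : ℕ) + 1) i.2
  rwa [spanPoly_firstVars_sizeUpTo_succ hQ, Polynomial.map_comp,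
    map_gAct_spanPoly_firstVars I hg i.2.le] at h

lemma gAct_qInv {Q : (m : ℕ) → ℕ → SV F m}
    (hQ : DicksonProp F (Fintype.card F) Q) {n : ℕ} (I : Composition n)
    {g : Matrix (Fin n) (Fin n) F} (hg : g ∈ PIset F n I) (i : Fin I.length) {k : ℕ}
    (hk : k ≤ I.blocksFun i) : gAct F n g (qInv F n Q I i k) = qInv F n Q I i k := by
  have h := congrArg (fun p => Polynomial.coeff p (Fintype.card F ^ k))
    (map_gAct_blockPoly hQ I hg i)
  simp only [Polynomial.coeff_map, blockPoly, coeff_spanPoly hQ _ hk] at h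
  rw [map_mul, map_pow, map_neg, map_one] at h
  exact mul_left_cancel₀ (pow_ne_zero _ (neg_ne_zero.mpr one_ne_zero)) h

/-- The generators `q_{i,n_i-j}`. -/
def qGen (Q : (m : ℕ) → ℕ → SV F m) {n : ℕ} (I : Composition n)
    (x : Σ i : Fin I.length, Fin (I.blocksFun i)) : SV F n :=
  qInv F n Q I x.1 (I.blocksFun x.1 - ((x.2 : ℕ) + 1))

lemma adjoin_qGen_le {Q : (m : ℕ) → ℕ → SV F m}
    (hQ : DicksonProp F (Fintype.card F) Q) {n : ℕ} (I : Composition n) :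
    Algebra.adjoin F (Set.range (qGen Q I)) ≤ invS F n (PIset F n I) := by
  rw [Algebra.adjoin_le_iff]
  rintro _ ⟨x, rfl⟩ g hg
  exact gAct_qInv hQ I hg x.1 (Nat.sub_le _ _)

lemma qInv_mem_adjoin {Q : (m : ℕ) → ℕ → SV F m}
    (hQ : DicksonProp F (Fintype.card F) Q) {n : ℕ} (I : Composition n) (i : Fin I.length)
    {k : ℕ} (hk : k ≤ I.blocksFun i) :
    qInv F n Q I i k ∈ Algebra.adjoin F (Set.range (qGen Q I)) := by
  rcases hk.eq_or_lt with rfl | hk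
  · rw [qInv, Q_self hQ, map_one]
    exact one_mem _
  · refine Algebra.subset_adjoin ⟨⟨i, ⟨I.blocksFun i - (k + 1), by omega⟩⟩, ?_⟩
    rw [qGen]
    congr 1
    simp only
    omega

lemma spanPoly_firstVars_mem_lifts {Q : (m : ℕ) → ℕ → SV F m}
    (hQ : DicksonProp F (Fintype.card F) Q) {n : ℕ} (I : Composition n) {i : ℕ}
    (hi : i ≤ I.length) :
    spanPoly F (firstVars F n (I.sizeUpTo i)) ∈
      Polynomial.lifts (algebraMap (Algebra.adjoin F (Set.range (qGen Q I))) (SV F n)) := by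
  induction i with
  | zero =>
    rw [I.sizeUpTo_zero]
    simpa [spanPoly] using Polynomial.X_mem_lifts _
  | succ i ih =>
    have h := spanPoly_firstVars_sizeUpTo_succ hQ I ⟨i, hi⟩
    rw [h, blockPoly, spanPoly_eq hQ, Polynomial.sum_comp]
    refine sum_mem fun k _ => ?_
    rw [Polynomial.mul_comp, Polynomial.C_comp, Polynomial.X_pow_comp]
    refine mul_mem ?_ (pow_mem (ih (by omega)) _)
    have hmem := qInv_mem_adjoin hQ I ⟨i, hi⟩ k.is_le
    exact Polynomial.C_mem_lifts _ (⟨_, mul_mem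
      (pow_mem (neg_mem (one_mem _)) ((k : ℕ) + I.blocksFun ⟨i, hi⟩)) hmem⟩ :
        Algebra.adjoin F (Set.range (qGen Q I)))

end Flag

section Galois

/-- An element of a domain `S`, generated over an integrally closed subring `A` by the roots of a
separable polynomial, belongs to `A` if it is fixed by all automorphisms of the fraction field
of `S` that fix `A`. -/
theorem mem_range_algebraMap_of_fixed {A S ι : Type*} [CommRing A] [IsDomain A]
    [IsIntegrallyClosed A] [CommRing S] [IsDomain S] [Algebra A S] [FaithfulSMul A S] [Fintype ι]
    (p : Polynomial A) (r : ι → S) (hr : Function.Injective r)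
    (hp : p.map (algebraMap A S) = ∏ u, (Polynomial.X - Polynomial.C (r u)))
    (hgen : Algebra.adjoin A (Set.range r) = ⊤) {f : S} (hf : IsIntegral A f)
    (hfix : ∀ σ : FractionRing S ≃+* FractionRing S,
      (∀ a, σ (algebraMap S (FractionRing S) (algebraMap A S a)) =
        algebraMap S (FractionRing S) (algebraMap A S a)) →
      σ (algebraMap S (FractionRing S) f) = algebraMap S (FractionRing S) f) :
    f ∈ Set.range (algebraMap A S) := by
  let K := FractionRing S
  let k := FractionRing A
  let : Algebra k K := FractionRing.liftAlgebra A K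
  have : IsScalarTower A k K := FractionRing.isScalarTower_liftAlgebra A K
  have hSK : Function.Injective (algebraMap S K) := IsFractionRing.injective S K
  have hmap : (p.map (algebraMap A k)).map (algebraMap k K) =
      ∏ u, (Polynomial.X - Polynomial.C (algebraMap S K (r u))) := by
    rw [Polynomial.map_map, ← IsScalarTower.algebraMap_eq, IsScalarTower.algebraMap_eq A S K,
      ← Polynomial.map_map, hp, Polynomial.map_prod]
    simp
  have hsep : (p.map (algebraMap A k)).Separable := by
    rw [← Polynomial.separable_map (algebraMap k K), hmap, Polynomial.separable_prod_X_sub_C_iff]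
    exact hSK.comp hr
  have hne : p.map (algebraMap A k) ≠ 0 := hsep.ne_zero
  have hsplit : (p.map (algebraMap A k)).IsSplittingField k K := by
    rw [isSplittingField_iff_intermediateField]
    refine ⟨?_, ?_⟩
    · rw [hmap]
      exact Polynomial.Splits.prod fun u _ => Polynomial.Splits.X_sub_C _
    · set E := IntermediateField.adjoin k ((p.map (algebraMap A k)).rootSet K) with hE
      have hS : ∀ s : S, algebraMap S K s ∈ E := by
        intro s
        have hs : s ∈ Algebra.adjoin A (Set.range r) := hgen ▸ Algebra.mem_top
        induction hs using Algebra.adjoin_induction with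
        | mem x hx =>
          obtain ⟨u, rfl⟩ := hx
          refine IntermediateField.subset_adjoin _ _ ?_
          rw [Polynomial.mem_rootSet', Polynomial.map_ne_zero_iff (algebraMap k K).injective,
            Polynomial.aeval_def, ← Polynomial.eval_map, hmap, Polynomial.eval_prod]
          refine ⟨hne, ?_⟩
          exact Finset.prod_eq_zero (Finset.mem_univ u) (by simp)
        | algebraMap a =>
          rw [← IsScalarTower.algebraMap_apply, IsScalarTower.algebraMap_apply A k K]
          exact E.algebraMap_mem _
        | add x y _ _ hx hy =>
          rw [map_add]
          exact add_mem hx hy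
        | mul x y _ _ hx hy =>
          rw [map_mul]
          exact mul_mem hx hy
      rw [eq_top_iff]
      intro z _
      obtain ⟨a, b, -, rfl⟩ := IsFractionRing.div_surjective (A := S) z
      exact div_mem (hS a) (hS b)
  have : IsGalois k K := IsGalois.of_separable_splitting_field hsep
  have : FiniteDimensional k K :=
    Polynomial.IsSplittingField.finiteDimensional K (p.map (algebraMap A k))
  obtain ⟨z, hz⟩ := (IsGalois.mem_range_algebraMap_iff_fixed (F := k) (algebraMap S K f)).mpr
    fun σ => hfix σ.toRingEquiv fun a => by
      rw [← IsScalarTower.algebraMap_apply A S K, IsScalarTower.algebraMap_apply A k K]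
      exact σ.commutes _
  have hzint : IsIntegral A z := by
    rw [← isIntegral_algebraMap_iff (algebraMap k K).injective, hz]
    exact hf.algebraMap
  obtain ⟨y, rfl⟩ := IsIntegrallyClosed.isIntegral_iff.mp hzint
  refine ⟨y, hSK ?_⟩
  rw [← hz, ← IsScalarTower.algebraMap_apply, ← IsScalarTower.algebraMap_apply]

variable {F : Type} [Field F]

lemma X_eq_linForm {n : ℕ} (k : Fin n) : (X k : SV F n) = linForm n (Pi.single k 1) := by
  simp [linForm, Pi.single_apply, ite_smul]

lemma adjoin_neg_linForm_eq_top {n : ℕ} (A : Subalgebra F (SV F n)) :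
    Algebra.adjoin A (Set.range fun u : flagSet F n n => -linForm n (u : Fin n → F)) = ⊤ := by
  rw [eq_top_iff]
  intro s _
  induction s using MvPolynomial.induction_on with
  | C a => exact Subalgebra.algebraMap_mem _ (algebraMap F A a)
  | add f g hf hg => exact add_mem (hf trivial) (hg trivial)
  | mul_X f k hf =>
    refine mul_mem (hf trivial) (Algebra.subset_adjoin
      ⟨⟨-Pi.single k 1, fun j hj => absurd j.2 (by omega)⟩, ?_⟩)
    rw [X_eq_linForm]
    simp [linForm]

variable [Fintype F]

lemma eval_map_spanPoly_firstVars_eq_zero_iff {n a : ℕ} (ha : a ≤ n) {R : Type*} [CommRing R]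
    [IsDomain R] (φ : SV F n →+* R) (y : R) :
    ((spanPoly F (firstVars F n a)).map φ).eval y = 0 ↔
      ∃ u ∈ flagSet F n a, y = φ (linForm n u) := by
  classical
  rw [spanPoly_firstVars_eq_prod ha, Polynomial.map_prod, Polynomial.eval_prod,
    Finset.prod_eq_zero_iff]
  have hneg : ∀ u : Fin n → F, linForm n (-u) = -linForm n u := fun u => by simp [linForm]
  constructor
  · rintro ⟨u, -, hu⟩
    refine ⟨-u.1, fun k hk => by simp [u.2 k hk], ?_⟩
    rw [hneg, map_neg, eq_neg_iff_add_eq_zero]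
    simpa using hu
  · rintro ⟨u, hu, rfl⟩
    refine ⟨⟨-u, fun k hk => by simp [hu k hk]⟩, Finset.mem_univ _, ?_⟩
    simp [hneg]

lemma eval_spanPoly_firstVars_X {n a : ℕ} (ha : a ≤ n) {k : Fin n} (hk : (k : ℕ) < a) :
    (spanPoly F (firstVars F n a)).eval (X k) = 0 := by
  have := (eval_map_spanPoly_firstVars_eq_zero_iff ha (RingHom.id (SV F n)) (X k)).mpr
    ⟨Pi.single k 1, fun j hj => by
      rw [Pi.single_eq_of_ne]
      rintro rfl
      omega, X_eq_linForm k⟩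
  simpa using this

variable {Q : (m : ℕ) → ℕ → SV F m} {n : ℕ}

lemma isIntegral_adjoin_qGen (hQ : DicksonProp F (Fintype.card F) Q) (I : Composition n) :
    Algebra.IsIntegral (Algebra.adjoin F (Set.range (qGen Q I))) (SV F n) := by
  have hlift := spanPoly_firstVars_mem_lifts hQ I (le_refl I.length)
  rw [I.sizeUpTo_length] at hlift
  obtain ⟨p, hp, -, hmonic⟩ := Polynomial.lifts_and_degree_eq_and_monic hlift (monic_spanPoly _)
  refine ⟨fun f => ?_⟩
  induction f using MvPolynomial.induction_on with
  | C a =>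
    exact isIntegral_algebraMap (A := SV F n)
      (x := algebraMap F (Algebra.adjoin F (Set.range (qGen Q I))) a)
  | add f g hf hg => exact hf.add hg
  | mul_X f k hf =>
    refine hf.mul ⟨p, hmonic, ?_⟩
    rw [← Polynomial.eval_map, hp]
    exact eval_spanPoly_firstVars_X le_rfl k.2

lemma algebraicIndependent_qGen (hQ : DicksonProp F (Fintype.card F) Q) (I : Composition n) :
    AlgebraicIndependent F (qGen Q I) := by
  have := isIntegral_adjoin_qGen hQ I
  refine (Algebra.IsAlgebraic.isTranscendenceBasis_of_lift_le_trdeg_of_finite F (qGen Q I) ?_).1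
  have h := Fintype.card_congr I.blocksFinEquiv
  rw [Fintype.card_fin] at h
  rw [MvPolynomial.trdeg_of_isDomain, Cardinal.mk_fintype, h]
  simp

lemma isIntegrallyClosed_adjoin_qGen (hQ : DicksonProp F (Fintype.card F) Q)
    (I : Composition n) :
    IsIntegrallyClosed (Algebra.adjoin F (Set.range (qGen Q I))) :=
  IsIntegrallyClosed.of_equiv (algebraicIndependent_qGen hQ I).aevalEquiv.toRingEquiv

/-- Automorphisms fixing the generators are given by elements of the parabolic subgroup. -/
lemma exists_mem_PIset (hQ : DicksonProp F (Fintype.card F) Q) (I : Composition n)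
    (σ : FractionRing (SV F n) ≃+* FractionRing (SV F n))
    (hσ : ∀ a ∈ Algebra.adjoin F (Set.range (qGen Q I)),
      σ (algebraMap (SV F n) (FractionRing (SV F n)) a) = algebraMap _ _ a) :
    ∃ g ∈ PIset F n I, ∀ f : SV F n, σ (algebraMap _ _ f) =
      algebraMap (SV F n) (FractionRing (SV F n)) (gAct F n g f) := by
  let ψ : SV F n →ₐ[F] FractionRing (SV F n) := IsScalarTower.toAlgHom F _ _
  let φ : SV F n →ₐ[F] FractionRing (SV F n) := 
    { toRingHom := (σ : FractionRing (SV F n) →+* FractionRing (SV F n)).comp (algebraMap _ _)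
      commutes' := fun a => (hσ _ (Subalgebra.algebraMap_mem _ a)).trans (ψ.commutes a) }
  have hψ : Function.Injective ψ := IsFractionRing.injective (SV F n) (FractionRing (SV F n))
  have hφ : Function.Injective φ := σ.injective.comp hψ
  have hroot : ∀ j : Fin n, ∃ u ∈ flagSet F n (I.sizeUpTo (blkIdx n I j + 1)),
      φ (X j) = ψ (linForm n u) := by
    intro j
    have hj := blkIdx_lt_length I j
    have hlt : (j : ℕ) < I.sizeUpTo (blkIdx n I j + 1) := by
      by_contra! h
      exact lt_irrefl _ ((lt_blkIdx_iff I hj).mpr h)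
    have hle := I.sizeUpTo_le (blkIdx n I j + 1)
    refine (eval_map_spanPoly_firstVars_eq_zero_iff hle
      (ψ : SV F n →+* FractionRing (SV F n)) _).mp ?_
    have hmap : (spanPoly F (firstVars F n (I.sizeUpTo (blkIdx n I j + 1)))).map
        (ψ : SV F n →+* FractionRing (SV F n)) = Polynomial.map
        (φ : SV F n →+* FractionRing (SV F n)) (spanPoly F (firstVars F n
          (I.sizeUpTo (blkIdx n I j + 1)))) := by
      ext k
      obtain ⟨a, ha⟩ := (Polynomial.lifts_iff_coeff_lifts _).mp
        (spanPoly_firstVars_mem_lifts hQ I hj) k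
      rw [Polynomial.coeff_map, Polynomial.coeff_map, ← ha]
      exact (hσ a a.2).symm
    rw [hmap]
    change Polynomial.eval ((φ : SV F n →+* FractionRing (SV F n)) (X j)) _ = 0
    rw [Polynomial.eval_map_apply, eval_spanPoly_firstVars_X hle hlt, map_zero]
  choose g hg hgφ using hroot
  have hlin := algHom_linForm φ (Matrix.of fun i j => g j i) hgφ
  refine ⟨Matrix.of fun i j => g j i, ⟨?_, fun a b hab => ?_⟩, fun f => ?_⟩
  · rw [← Matrix.isUnit_iff_isUnit_det, ← Matrix.mulVec_injective_iff_isUnit]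
    intro u v huv
    refine linForm_injective n (hφ ?_)
    rw [hlin, hlin, huv]
  · exact hg b a ((lt_blkIdx_iff I (blkIdx_lt_length I b)).mp hab)
  · have : φ = ψ.comp (gAct F n (Matrix.of fun i j => g j i)) :=
      MvPolynomial.algHom_ext fun j =>
        (hgφ j).trans (by rw [AlgHom.comp_apply ψ, gAct_X]; rfl)
    exact DFunLike.congr_fun this f

lemma adjoin_qGen_eq (hQ : DicksonProp F (Fintype.card F) Q) (I : Composition n) :
    Algebra.adjoin F (Set.range (qGen Q I)) = invS F n (PIset F n I) := by
  classical
  refine le_antisymm (adjoin_qGen_le hQ I) fun f hf => ?_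
  have := isIntegral_adjoin_qGen hQ I
  have := isIntegrallyClosed_adjoin_qGen hQ I
  have hlift := spanPoly_firstVars_mem_lifts hQ I (le_refl I.length)
  rw [I.sizeUpTo_length] at hlift
  obtain ⟨p, hp⟩ := (Polynomial.mem_lifts _).mp hlift
  rw [spanPoly_firstVars_eq_prod le_rfl] at hp
  suffices h : f ∈ Set.range (algebraMap (Algebra.adjoin F (Set.range (qGen Q I))) (SV F n)) by
    obtain ⟨y, rfl⟩ := h
    exact y.2
  refine mem_range_algebraMap_of_fixed p (fun u : flagSet F n n => -linForm n u.1)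
    (fun u v huv => Subtype.ext (linForm_injective n (neg_injective huv))) ?_ ?_
    (Algebra.IsIntegral.isIntegral f) fun σ hσ => ?_
  · rw [hp]
    simp
  · exact adjoin_neg_linForm_eq_top _
  · obtain ⟨g, hg, hgσ⟩ := exists_mem_PIset hQ I σ fun a ha => hσ ⟨a, ha⟩
    rw [hgσ, hf g hg]

end Galois

section Homogeneity

variable {F : Type} [Field F]

lemma isHomogeneous_xV (n a : ℕ) : (xV F n a).IsHomogeneous 1 := by
  rw [xV]
  split_ifs
  · exact isHomogeneous_X _ _
  · exact isHomogeneous_zero _ _ _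

variable [Fintype F]

lemma isHomogeneous_linProd (n a t : ℕ) :
    (linProd F n a t).IsHomogeneous (Fintype.card F ^ a) := by
  have h := IsHomogeneous.prod (Finset.univ : Finset (Fin a → F))
    (fun c => (∑ k : Fin a, MvPolynomial.C (c k) * xV F n k) + xV F n t) (fun _ => 1)
    fun c _ => (IsHomogeneous.sum _ _ _ fun k _ => by
      simpa using (isHomogeneous_C _ (c k)).mul (isHomogeneous_xV n k)).add (isHomogeneous_xV n t)
  simpa [linProd] using h

lemma isHomogeneous_qInv {Q : (m : ℕ) → ℕ → SV F m} (hQ : DicksonProp F (Fintype.card F) Q)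
    {n : ℕ} (I : Composition n) (i : Fin I.length) {j : ℕ} (hj : j ≤ I.blocksFun i) :
    (qInv F n Q I i (I.blocksFun i - j)).IsHomogeneous
      (Fintype.card F ^ I.sizeUpTo ((i : ℕ) + 1) -
        Fintype.card F ^ (I.sizeUpTo ((i : ℕ) + 1) - j)) := by
  have h := (isHomogeneous_Q hQ (Nat.sub_le (I.blocksFun i) j)).aeval
    (fun t : Fin (I.blocksFun i) => vij F n I i t) fun t => isHomogeneous_linProd n _ _
  rwa [Nat.mul_sub, ← pow_add, ← pow_add, ← Nat.add_sub_assoc hj, ← I.sizeUpTo_succ'] at h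

end Homogeneity

section Hilbert

/-- The geometric series in `X ^ d`. -/
lemma one_sub_X_pow_mul_mk {d : ℕ} (hd : 0 < d) :
    (1 - (PowerSeries.X : PowerSeries ℤ) ^ d) *
      PowerSeries.mk (fun k => if d ∣ k then 1 else 0) = 1 := by
  ext k
  rw [sub_mul, one_mul, map_sub, PowerSeries.coeff_X_pow_mul', PowerSeries.coeff_mk,
    PowerSeries.coeff_one]
  by_cases hk : k = 0
  · simp [hk, hd.ne']
  by_cases hdk : d ≤ k
  · simp [hk, hdk, (Nat.dvd_sub_iff_left hdk dvd_rfl)]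
  · simp [hk, hdk, Nat.not_dvd_of_pos_of_lt (Nat.pos_of_ne_zero hk) (not_le.mp hdk)]

variable {ι : Type*} [Fintype ι]

lemma prod_one_sub_X_pow_mul_mk_card (d : ι → ℕ) (hd : ∀ i, 0 < d i) :
    (∏ i, (1 - (PowerSeries.X : PowerSeries ℤ) ^ d i)) *
      PowerSeries.mk (fun k => (Nat.card {e : ι →₀ ℕ | Finsupp.weight d e = k} : ℤ)) = 1 := by
  classical
  have h : PowerSeries.mk (fun k => (Nat.card {e : ι →₀ ℕ | Finsupp.weight d e = k} : ℤ)) =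
      ∏ i, PowerSeries.mk (fun k => if d i ∣ k then 1 else 0) := by
    ext k
    rw [PowerSeries.coeff_mk, PowerSeries.coeff_prod]
    simp only [PowerSeries.coeff_mk]
    simp only [Finset.prod_boole, Finset.mem_univ, true_imp_iff, Finset.sum_boole]
    congr 1
    rw [← Fintype.card_coe, ← Nat.card_eq_fintype_card]
    refine Nat.card_eq_of_bijective (fun e => ⟨Finsupp.equivFunOnFinite.symm
      fun i => d i * (e : ι →₀ ℕ) i, ?_⟩) ⟨fun e e' he => ?_, fun l => ?_⟩
    · have he := e.2
      rw [Set.mem_ofPred_eq, Finsupp.weight_apply, Finsupp.sum_fintype _ _ (by simp)] at he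
      simpa [Finset.mem_finsuppAntidiag, mul_comm] using he
    · ext i
      have hi := DFunLike.congr_fun (Subtype.ext_iff.mp he) i
      exact Nat.eq_of_mul_eq_mul_left (hd i) hi
    · obtain ⟨l, hl⟩ := l
      rw [Finset.mem_filter, Finset.mem_finsuppAntidiag] at hl
      refine ⟨⟨Finsupp.equivFunOnFinite.symm fun i => l i / d i, ?_⟩, ?_⟩
      · rw [Set.mem_ofPred_eq, Finsupp.weight_apply, Finsupp.sum_fintype _ _ (by simp)]
        simpa [Nat.div_mul_cancel (hl.2 _)] using hl.1.1
      · ext i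
        simp [Nat.mul_div_cancel' (hl.2 i)]
  rw [h, ← Finset.prod_mul_distrib]
  exact Finset.prod_eq_one fun i _ => one_sub_X_pow_mul_mk (hd i)

variable {F : Type} [Field F] {n : ℕ}

lemma isHomogeneous_aeval {d : ι → ℕ} {x : ι → SV F n}
    (hx : ∀ i, (x i).IsHomogeneous (d i)) {P : MvPolynomial ι F} {k : ℕ}
    (hP : P.IsWeightedHomogeneous d k) : (aeval x P).IsHomogeneous k := by
  rw [P.as_sum, map_sum]
  refine IsHomogeneous.sum _ _ _ fun e he => ?_
  rw [aeval_monomial, Finsupp.prod_fintype _ _ (by simp)]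
  have h := (isHomogeneous_C (Fin n) (coeff e P)).mul (IsHomogeneous.prod Finset.univ
    (fun i => x i ^ e i) (fun i => d i * e i) fun i _ => (hx i).pow (e i))
  rw [← hP (mem_support_iff.mp he), Finsupp.weight_apply, Finsupp.sum_fintype _ _ (by simp)]
  simpa [mul_comm] using h

lemma homogeneousComponent_aeval {d : ι → ℕ} {x : ι → SV F n}
    (hx : ∀ i, (x i).IsHomogeneous (d i)) (P : MvPolynomial ι F) (k : ℕ) :
    homogeneousComponent k (aeval x P) = aeval x (weightedHomogeneousComponent d k P) := by
  classical
  induction P using MvPolynomial.induction_on' with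
  | monomial e a =>
    have he := isWeightedHomogeneous_monomial d e a rfl
    rw [weightedHomogeneousComponent_of_mem he,
      homogeneousComponent_of_mem (isHomogeneous_aeval hx he)]
    split_ifs <;> simp
  | add P P' h h' => simp only [map_add, h, h']

lemma map_weightedHomogeneousSubmodule {d : ι → ℕ} {x : ι → SV F n}
    (hx : ∀ i, (x i).IsHomogeneous (d i)) (k : ℕ) :
    (weightedHomogeneousSubmodule F d k).map (aeval x).toLinearMap =
      Subalgebra.toSubmodule (Algebra.adjoin F (Set.range x)) ⊓
        homogeneousSubmodule (Fin n) F k := by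
  classical
  refine le_antisymm ?_ ?_
  · rintro _ ⟨P, hP, rfl⟩
    refine ⟨?_, isHomogeneous_aeval hx hP⟩
    rw [Algebra.adjoin_range_eq_range_aeval]
    exact ⟨P, rfl⟩
  · rintro f ⟨hf, hfk⟩
    rw [Algebra.adjoin_range_eq_range_aeval] at hf
    obtain ⟨P, rfl⟩ := hf
    refine ⟨weightedHomogeneousComponent d k P, weightedHomogeneousComponent_mem d P k, ?_⟩
    have h := homogeneousComponent_aeval hx P k
    exact h.symm.trans ((homogeneousComponent_of_mem hfk).trans (if_pos rfl))

lemma finrank_adjoin_inf_homogeneousSubmodule {d : ι → ℕ} {x : ι → SV F n}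
    (hx : ∀ i, (x i).IsHomogeneous (d i)) (hind : AlgebraicIndependent F x) (k : ℕ) :
    Module.finrank F ↥(Subalgebra.toSubmodule (Algebra.adjoin F (Set.range x)) ⊓
        homogeneousSubmodule (Fin n) F k) =
      Nat.card {e : ι →₀ ℕ | Finsupp.weight d e = k} := by
  rw [← map_weightedHomogeneousSubmodule hx,
    ← (Submodule.equivMapOfInjective (aeval x : MvPolynomial ι F →ₐ[F] SV F n).toLinearMap hind
      _).finrank_eq,
    weightedHomogeneousSubmodule_eq_finsupp_supported,
    ← restrictSupport, Module.finrank_eq_nat_card_basis (basisRestrictSupport F _)]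

lemma prod_one_sub_X_pow_mul_HserS_adjoin {d : ι → ℕ} (hd : ∀ i, 0 < d i) {x : ι → SV F n}
    (hx : ∀ i, (x i).IsHomogeneous (d i)) (hind : AlgebraicIndependent F x) :
    (∏ i, (1 - (PowerSeries.X : PowerSeries ℤ) ^ d i)) *
      HserS F n (Algebra.adjoin F (Set.range x)) = 1 := by
  rw [HserS]
  simp only [finrank_adjoin_inf_homogeneousSubmodule hx hind]
  exact prod_one_sub_X_pow_mul_mk_card d hd

end Hilbert

/-- **Theorem 2.1** (Kuhn–Mitchell, Hewett). The `q_{i,n_i−j}` are homogeneous of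
degree `q^{m_i} − q^{m_i−j}`, algebraically independent, and generate
`S(V)^{P_I}` as a polynomial algebra; consequently the Hilbert series of
`S(V)^{P_I}` is `1 / ∏_{i=1}^{ℓ} ∏_{j=1}^{n_i} (1 − t^{q^{m_i} − q^{m_i−j}})`
(stated with the denominator cleared, in `ℤ[[t]]`). -/
theorem kuhn_mitchell_parabolic_invariants
    (F : Type) [Field F] [Fintype F] (p r q n : ℕ)
    (hp : p.Prime) (hr : 0 < r) (hq : q = p ^ r) (hF : Fintype.card F = q)
    (Q : (m : ℕ) → ℕ → SV F m) (hQ : DicksonProp F q Q)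
    (I : Composition n) :
    (∀ i : Fin I.length, ∀ j ∈ Finset.Icc 1 (I.blocksFun i),
      MvPolynomial.IsHomogeneous (qInv F n Q I i (I.blocksFun i - j))
        (q ^ I.sizeUpTo ((i : ℕ) + 1) - q ^ (I.sizeUpTo ((i : ℕ) + 1) - j)))
    ∧ AlgebraicIndependent F
        (fun x : Σ i : Fin I.length, Fin (I.blocksFun i) =>
          qInv F n Q I x.1 (I.blocksFun x.1 - ((x.2 : ℕ) + 1)))
    ∧ Algebra.adjoin F
        (Set.range fun x : Σ i : Fin I.length, Fin (I.blocksFun i) =>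
          qInv F n Q I x.1 (I.blocksFun x.1 - ((x.2 : ℕ) + 1)))
      = invS F n (PIset F n I)
    ∧ (∏ i : Fin I.length, ∏ j ∈ Finset.Icc 1 (I.blocksFun i),
        (1 - (PowerSeries.X : PowerSeries ℤ) ^
          (q ^ I.sizeUpTo ((i : ℕ) + 1) - q ^ (I.sizeUpTo ((i : ℕ) + 1) - j))))
        * HserS F n (invS F n (PIset F n I)) = 1 := by
  clear hq
  subst hF
  refine ⟨fun i j hj => isHomogeneous_qInv hQ I i (Finset.mem_Icc.mp hj).2,
    algebraicIndependent_qGen hQ I, adjoin_qGen_eq hQ I, ?_⟩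
  let d (x : Σ i : Fin I.length, Fin (I.blocksFun i)) : ℕ :=
    Fintype.card F ^ I.sizeUpTo ((x.1 : ℕ) + 1) -
      Fintype.card F ^ (I.sizeUpTo ((x.1 : ℕ) + 1) - ((x.2 : ℕ) + 1))
  have hd : ∀ x, 0 < d x := fun ⟨i, j⟩ => by
    refine Nat.sub_pos_of_lt (Nat.pow_lt_pow_right Fintype.one_lt_card ?_)
    have := I.sizeUpTo_succ' i
    have := j.2
    simp only
    omega
  have hprod : ∀ i : Fin I.length, ∏ j ∈ Finset.Icc 1 (I.blocksFun i),
      (1 - (PowerSeries.X : PowerSeries ℤ) ^ (Fintype.card F ^ I.sizeUpTo ((i : ℕ) + 1) -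
        Fintype.card F ^ (I.sizeUpTo ((i : ℕ) + 1) - j))) =
      ∏ j : Fin (I.blocksFun i), (1 - (PowerSeries.X : PowerSeries ℤ) ^ d ⟨i, j⟩) := by
    intro i
    rw [← Finset.Ico_add_one_right_eq_Icc, Finset.prod_Ico_eq_prod_range,
      ← Fin.prod_univ_eq_prod_range]
    simp only [add_comm 1, d]
    rfl
  rw [Finset.prod_congr rfl fun i _ => hprod i, 
    ← Fintype.prod_sigma fun x => 1 - (PowerSeries.X : PowerSeries ℤ) ^ d x, ← adjoin_qGen_eq hQ I]
  exact prod_one_sub_X_pow_mul_HserS_adjoin hd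
    (fun x => isHomogeneous_qInv hQ I x.1 (Nat.succ_le_of_lt x.2.2))
    (algebraicIndependent_qGen hQ I)

end
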